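/- Let $g : [0,1]^{2} \to \mathbb{R}$ be continuous. Then $\lim_{\varepsilon \to 0^{+}} \varepsilon \int_{0}^{1}\! \int_{0}^{1} \frac{4\, g(r_{1}, r_{2})}{r_{1} r_{2}\, u(r_1,r_2)^{2}\, \big(1 + \log u(r_1,r_2)\big)^{1+\varepsilon}}\, dr_{1}\, dr_{2} = g(0,0)$, where $u(r_1,r_2) := 1 - \log r_{1}^{2} - \log r_{2}^{2}$. -/

import Mathlib

open Real MeasureTheory Set Filter intervalIntegral

namespace Stmt11Aux

noncomputable def U (a b : ℝ) : ℝ := 1 - Real.log (a ^ 2) - Real.log (b ^ 2)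
noncomputable def L (a b : ℝ) : ℝ := 1 + Real.log (U a b)
noncomputable def K (p : ℝ) (z : ℝ × ℝ) : ℝ := 4 / (z.1 * z.2 * U z.1 z.2 ^ 2 * L z.1 z.2 ^ p)
noncomputable def G (p : ℝ) (z : ℝ × ℝ) : ℝ := K p z + p * K (p + 1) z
noncomputable def ν : Measure ℝ := volume.restrict (Ioc (0:ℝ) 1)
noncomputable def φ (δ a : ℝ) : ℝ := (Iic δ).indicator (fun _ => (1:ℝ)) a

lemma U_ge {a b : ℝ} (ha : a ∈ Ioc (0:ℝ) 1) (hb : b ∈ Ioc (0:ℝ) 1) : 1 ≤ U a b := by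
  unfold U
  have h1 : Real.log (a ^ 2) ≤ 0 := Real.log_nonpos (by positivity) (by nlinarith [ha.1, ha.2])
  have h2 : Real.log (b ^ 2) ≤ 0 := Real.log_nonpos (by positivity) (by nlinarith [hb.1, hb.2])
  linarith

lemma L_ge {a b : ℝ} (ha : a ∈ Ioc (0:ℝ) 1) (hb : b ∈ Ioc (0:ℝ) 1) : 1 ≤ L a b := by
  unfold L
  have := Real.log_nonneg (U_ge ha hb)
  linarith

lemma K_nonneg (p : ℝ) {z : ℝ × ℝ} (ha : z.1 ∈ Ioc (0:ℝ) 1) (hb : z.2 ∈ Ioc (0:ℝ) 1) :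
    0 ≤ K p z := by
  have h1 := U_ge ha hb
  have h2 := L_ge ha hb
  have := ha.1
  have := hb.1
  unfold K
  have : 0 ≤ L z.1 z.2 ^ p := Real.rpow_nonneg (by linarith) _
  positivity

lemma ftc {f f' : ℝ → ℝ} {δ : ℝ} (hδ : 0 < δ) (hd : ∀ x ∈ Ioc 0 δ, HasDerivAt f (f' x) x)
    (hn : ∀ x ∈ Ioc 0 δ, 0 ≤ f' x) (h0 : Tendsto f (nhdsWithin 0 (Ioi 0)) (nhds 0)) :
    IntegrableOn f' (Ioc 0 δ) ∧ ∫ x in Ioc 0 δ, f' x = f δ := by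
  have hi : IntegrableOn f' (Ioc 0 δ) := by
    apply integrableOn_deriv_of_nonneg (g := Function.update f 0 0)
    · intro x hx
      rcases eq_or_lt_of_le hx.1 with h | h
      · subst h
        rw [continuousWithinAt_update_same]
        apply h0.mono_left
        apply nhdsWithin_mono
        intro y hy
        exact lt_of_le_of_ne hy.1.1 (fun h => hy.2 h.symm)
      · apply ContinuousAt.continuousWithinAt
        exact (continuousAt_update_of_ne h.ne').2 (hd x ⟨h, hx.2⟩).continuousAt
    · intro x hx
      apply (hd x ⟨hx.1, hx.2.le⟩).congr_of_eventuallyEq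
      filter_upwards [lt_mem_nhds hx.1] with y hy
      exact Function.update_of_ne hy.ne' _ _
    · intro x hx
      exact hn x ⟨hx.1, hx.2.le⟩
  refine ⟨hi, ?_⟩
  have := integral_eq_sub_of_hasDerivAt_of_tendsto hδ (fun x hx => hd x ⟨hx.1, hx.2.le⟩)
    ((intervalIntegrable_iff_integrableOn_Ioc_of_le hδ.le).2 hi) h0
    (((hd δ ⟨hδ, le_rfl⟩).continuousAt.tendsto).mono_left nhdsWithin_le_nhds)
  rw [intervalIntegral.integral_of_le hδ.le] at this
  simpa using this

lemma U_tendsto (a : ℝ) : Tendsto (U a) (nhdsWithin 0 (Ioi 0)) atTop := by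
  have h : Tendsto (fun b : ℝ => (1 - Real.log (a^2)) + (-2) * Real.log b)
      (nhdsWithin 0 (Ioi 0)) atTop := by
    apply tendsto_atTop_add_const_left
    exact Real.tendsto_log_nhdsGT_zero.const_mul_atBot_of_neg (by norm_num)
  refine h.congr fun b => ?_
  simp only [U, Real.log_pow]; push_cast; ring

lemma L_tendsto (a : ℝ) : Tendsto (L a) (nhdsWithin 0 (Ioi 0)) atTop :=
  tendsto_atTop_add_const_left _ _ (Real.tendsto_log_atTop.comp (U_tendsto a))

lemma U_deriv (a : ℝ) {b : ℝ} (hb : 0 < b) : HasDerivAt (U a) (-2 / b) b := by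
  have h : HasDerivAt (fun b : ℝ => (1 - Real.log (a^2)) + (-2) * Real.log b) ((-2) * b⁻¹) b :=
    ((Real.hasDerivAt_log hb.ne').const_mul (-2)).const_add _
  have e : U a = (fun b : ℝ => (1 - Real.log (a^2)) + (-2) * Real.log b) := by
    funext b; simp only [U, Real.log_pow]; push_cast; ring
  rw [e]; exact h.congr_deriv (by ring)

lemma L_deriv {a b : ℝ} (ha : a ∈ Ioc (0:ℝ) 1) (hb : b ∈ Ioc (0:ℝ) 1) :
    HasDerivAt (L a) (-2 / b / U a b) b :=
  ((U_deriv a hb.1).log (by linarith [U_ge ha hb])).const_add _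

lemma inner_G {p : ℝ} (hp : 0 < p) {a : ℝ} (ha : a ∈ Ioc (0:ℝ) 1) :
    IntegrableOn (fun b => G p (a, b)) (Ioc 0 1) ∧
      ∫ b in Ioc (0:ℝ) 1, G p (a, b) = 2 / a * ((U a 1)⁻¹ * L a 1 ^ (-p)) := by
  apply ftc (f := fun b => 2 / a * ((U a b)⁻¹ * L a b ^ (-p))) one_pos
  · intro b hb
    have hU := U_ge ha hb
    have hL := L_ge ha hb
    have hU0 : U a b ≠ 0 := by linarith
    have hL0 : 0 < L a b := by linarith
    have ha0 := ha.1.ne'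
    have hb0 := hb.1.ne'
    have h := (((U_deriv a hb.1).inv hU0).mul
      ((L_deriv ha hb).rpow_const (p := -p) (Or.inl hL0.ne'))).const_mul (2 / a)
    refine h.congr_deriv ?_
    symm
    have hq : L a b ^ p ≠ 0 := (Real.rpow_pos_of_pos hL0 p).ne'
    simp only [G, K, Pi.inv_apply]
    rw [Real.rpow_sub hL0, Real.rpow_neg hL0.le, Real.rpow_add hL0, Real.rpow_one]
    have := hL0.ne'
    field_simp
    ring
  · intro b hb
    have h1 := K_nonneg p (z := (a, b)) ha hb
    have h2 := K_nonneg (p+1) (z := (a, b)) ha hb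
    unfold G; positivity
  · have h := ((U_tendsto a).inv_tendsto_atTop.mul
      ((tendsto_rpow_neg_atTop hp).comp (L_tendsto a))).const_mul (2 / a)
    simpa using h

lemma U_comm (a b : ℝ) : U a b = U b a := by unfold U; ring
lemma L_comm (a b : ℝ) : L a b = L b a := by unfold L; rw [U_comm]
lemma K_swap (p : ℝ) (z : ℝ × ℝ) : K p z.swap = K p z := by
  simp only [K, Prod.fst_swap, Prod.snd_swap]
  rw [U_comm, L_comm, mul_comm z.2 z.1]
lemma G_swap (p : ℝ) (z : ℝ × ℝ) : G p z.swap = G p z := by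
  simp only [G, K_swap]

lemma one_mem : (1:ℝ) ∈ Ioc (0:ℝ) 1 := ⟨one_pos, le_rfl⟩

lemma outer {p : ℝ} (hp : 1 < p) {δ : ℝ} (hδ : δ ∈ Ioc (0:ℝ) 1) :
    IntegrableOn (fun a => 2 / a * ((U a 1)⁻¹ * L a 1 ^ (-p))) (Ioc 0 δ) ∧
      ∫ a in Ioc (0:ℝ) δ, 2 / a * ((U a 1)⁻¹ * L a 1 ^ (-p)) = L 1 δ ^ (-(p-1)) / (p - 1) := by
  apply ftc (f := fun a => L 1 a ^ (-(p-1)) / (p - 1)) hδ.1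
  · intro a ha'
    have ha : a ∈ Ioc (0:ℝ) 1 := ⟨ha'.1, ha'.2.trans hδ.2⟩
    have hU := U_ge one_mem ha
    have hL := L_ge one_mem ha
    have hU0 : U 1 a ≠ 0 := by linarith
    have hL0 : 0 < L 1 a := by linarith
    have ha0 := ha.1.ne'
    have hp0 : p - 1 ≠ 0 := by linarith
    have h := ((L_deriv one_mem ha).rpow_const (p := -(p-1)) (Or.inl hL0.ne')).div_const (p - 1)
    refine h.congr_deriv ?_
    rw [U_comm a 1, L_comm a 1, show -(p-1) - 1 = -p by ring]
    field_simp
  · intro a ha'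
    have ha : a ∈ Ioc (0:ℝ) 1 := ⟨ha'.1, ha'.2.trans hδ.2⟩
    have hU := U_ge ha one_mem
    have hL := L_ge ha one_mem
    have : 0 ≤ L a 1 ^ (-p) := Real.rpow_nonneg (by linarith) _
    have := ha.1
    positivity
  · have h := ((tendsto_rpow_neg_atTop (show 0 < p - 1 by linarith)).comp
      (L_tendsto 1)).div_const (p - 1)
    simpa using h

instance : IsFiniteMeasure ν := by unfold ν; infer_instance

lemma ae_mem : ∀ᵐ z ∂(ν.prod ν), z.1 ∈ Ioc (0:ℝ) 1 ∧ z.2 ∈ Ioc (0:ℝ) 1 := by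
  unfold ν
  rw [Measure.prod_restrict]
  exact ae_restrict_mem (measurableSet_Ioc.prod measurableSet_Ioc)

lemma K_meas (p : ℝ) : Measurable (K p) := by
  unfold K L U; fun_prop

lemma G_meas (p : ℝ) : Measurable (G p) := 
  (K_meas p).add ((K_meas (p+1)).const_mul p)

lemma G_nonneg {p : ℝ} (hp : 0 < p) {z : ℝ × ℝ} (ha : z.1 ∈ Ioc (0:ℝ) 1)
    (hb : z.2 ∈ Ioc (0:ℝ) 1) : 0 ≤ G p z := by
  have h1 := K_nonneg p ha hb
  have h2 := K_nonneg (p+1) ha hb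
  unfold G; positivity

lemma K_le_G {p : ℝ} (hp : 0 < p) {z : ℝ × ℝ} (ha : z.1 ∈ Ioc (0:ℝ) 1)
    (hb : z.2 ∈ Ioc (0:ℝ) 1) : K p z ≤ G p z := by
  have h2 := K_nonneg (p+1) ha hb
  have : 0 ≤ p * K (p+1) z := by positivity
  unfold G; linarith

lemma G_int {p : ℝ} (hp : 1 < p) : Integrable (G p) (ν.prod ν) := by
  rw [integrable_prod_iff (G_meas p).aestronglyMeasurable]
  have hm : ∀ᵐ a ∂ν, a ∈ Ioc (0:ℝ) 1 := ae_restrict_mem measurableSet_Ioc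
  constructor
  · filter_upwards [hm] with a ha
    exact (inner_G (by linarith) ha).1
  · refine Integrable.congr (outer hp one_mem).1 ?_
    filter_upwards [hm] with a ha
    rw [← (inner_G (by linarith) ha).2]
    apply setIntegral_congr_fun measurableSet_Ioc
    intro b hb
    exact (Real.norm_of_nonneg (G_nonneg (z := (a, b)) (by linarith) ha hb)).symm

lemma K_int {p : ℝ} (hp : 1 < p) : Integrable (K p) (ν.prod ν) := by
  apply (G_int hp).mono' (K_meas p).aestronglyMeasurable
  filter_upwards [ae_mem] with z hz
  rw [Real.norm_of_nonneg (K_nonneg p hz.1 hz.2)]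
  exact K_le_G (by linarith) hz.1 hz.2

lemma φ_meas (δ : ℝ) : Measurable (φ δ) := measurable_const.indicator measurableSet_Iic

lemma φ_bd (δ a : ℝ) : ‖φ δ a‖ ≤ 1 := by
  unfold φ indicator; split_ifs <;> simp

lemma Gφ_int {p : ℝ} (hp : 1 < p) (δ : ℝ) :
    Integrable (fun z => G p z * φ δ z.1) (ν.prod ν) :=
  (G_int hp).mul_bdd (c := 1) ((φ_meas δ).comp measurable_fst).aestronglyMeasurable
    (Eventually.of_forall fun z => φ_bd δ z.1)

lemma Gφ_int' {p : ℝ} (hp : 1 < p) (δ : ℝ) :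
    Integrable (fun z => G p z * φ δ z.2) (ν.prod ν) :=
  (G_int hp).mul_bdd (c := 1) ((φ_meas δ).comp measurable_snd).aestronglyMeasurable
    (Eventually.of_forall fun z => φ_bd δ z.2)

lemma Gφ {p : ℝ} (hp : 1 < p) {δ : ℝ} (hδ : δ ∈ Ioc (0:ℝ) 1) :
    ∫ z, G p z * φ δ z.1 ∂(ν.prod ν) = L 1 δ ^ (-(p-1)) / (p - 1) := by
  rw [integral_prod _ (Gφ_int hp δ), ← (outer hp hδ).2]
  have hm : ∀ᵐ a ∂ν, a ∈ Ioc (0:ℝ) 1 := ae_restrict_mem measurableSet_Ioc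
  have : ∀ᵐ a ∂ν, ∫ b, G p (a, b) * φ δ a ∂ν =
      (Iic δ).indicator (fun a => 2 / a * ((U a 1)⁻¹ * L a 1 ^ (-p))) a := by
    filter_upwards [hm] with a ha
    rw [MeasureTheory.integral_mul_const]
    have := (inner_G (p := p) (by linarith) ha).2
    change ∫ b, G p (a, b) ∂ν = _ at this
    rw [this]
    unfold φ indicator
    split_ifs <;> simp
  rw [MeasureTheory.integral_congr_ae this, MeasureTheory.integral_indicator measurableSet_Iic]
  unfold ν
  rw [Measure.restrict_restrict measurableSet_Iic]
  congr 2
  ext x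
  simp only [mem_inter_iff, mem_Iic, mem_Ioc]
  have := hδ.2
  constructor
  · rintro ⟨h1, h2, h3⟩; exact ⟨h2, h1⟩
  · rintro ⟨h1, h2⟩; exact ⟨h2, h1, h2.trans this⟩

lemma Gφ' {p : ℝ} (hp : 1 < p) {δ : ℝ} (hδ : δ ∈ Ioc (0:ℝ) 1) :
    ∫ z, G p z * φ δ z.2 ∂(ν.prod ν) = L 1 δ ^ (-(p-1)) / (p - 1) := by
  rw [← Gφ hp hδ, ← integral_prod_swap]
  simp only [G_swap, Prod.snd_swap]

lemma G_integral {p : ℝ} (hp : 1 < p) : ∫ z, G p z ∂(ν.prod ν) = 1 / (p - 1) := by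
  have h := Gφ hp one_mem
  have e : L 1 1 = 1 := by simp [L, U]
  rw [e, Real.one_rpow] at h
  rw [← h]
  apply MeasureTheory.integral_congr_ae
  filter_upwards [ae_mem] with z hz
  have : φ 1 z.1 = 1 := by simp [φ, hz.1.2]
  rw [this, mul_one]

lemma key {ε : ℝ} (hε : 0 < ε) {g : ℝ × ℝ → ℝ} {M η δ : ℝ} (hδ : δ ∈ Ioc (0:ℝ) 1)
    (hM0 : 0 ≤ M) (hη : 0 ≤ η)
    (hgm : AEStronglyMeasurable g (ν.prod ν))
    (hM : ∀ z : ℝ × ℝ, z.1 ∈ Icc (0:ℝ) 1 → z.2 ∈ Icc (0:ℝ) 1 → |g z| ≤ M)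
    (hg : ∀ z : ℝ × ℝ, z.1 ∈ Ioc 0 δ → z.2 ∈ Ioc 0 δ → |g z - g (0, 0)| ≤ η) :
    |ε * (∫ z, K (1 + ε) z * g z ∂(ν.prod ν)) - g (0, 0)| ≤
      η + 4 * M * (1 - L 1 δ ^ (-ε)) + ε * M := by
  have hp : 1 < 1 + ε := by linarith
  have hp2 : 1 < 1 + ε + 1 := by linarith
  have hgb : ∀ᵐ z ∂(ν.prod ν), ‖g z‖ ≤ M := by
    filter_upwards [ae_mem] with z hz
    exact hM z ⟨hz.1.1.le, hz.1.2⟩ ⟨hz.2.1.le, hz.2.2⟩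
  have h00 : |g (0, 0)| ≤ M := hM _ (by simp) (by simp)
  have iG := G_int hp
  have iGg : Integrable (fun z => G (1+ε) z * g z) (ν.prod ν) := iG.mul_bdd (c := M) hgm hgb
  have iK2 : Integrable (fun z => K (1+ε+1) z * g z) (ν.prod ν) :=
    (K_int hp2).mul_bdd (c := M) hgm hgb
  have I1 := G_integral hp
  have I2 := Gφ hp hδ
  have I3 := Gφ' hp hδ
  rw [show 1 + ε - 1 = ε by ring] at I1 I2 I3
  have e1 : ∫ z, K (1 + ε) z * g z ∂(ν.prod ν) =
      (∫ z, G (1+ε) z * g z ∂(ν.prod ν)) - (1+ε) * ∫ z, K (1+ε+1) z * g z ∂(ν.prod ν) := by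
    rw [← MeasureTheory.integral_const_mul, ← MeasureTheory.integral_sub iGg (iK2.const_mul _)]
    congr 1; funext z; unfold G; ring
  have e2 : ∫ z, G (1+ε) z * (g z - g (0,0)) ∂(ν.prod ν) =
      (∫ z, G (1+ε) z * g z ∂(ν.prod ν)) - 1 / ε * g (0,0) := by
    rw [← I1, ← MeasureTheory.integral_mul_const, ← MeasureTheory.integral_sub iGg (iG.mul_const _)]
    congr 1; funext z; ring
  have b1 : |∫ z, K (1+ε+1) z * g z ∂(ν.prod ν)| ≤ M * (1 / (1 + ε)) := by
    have I4 := G_integral hp2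
    rw [show 1 + ε + 1 - 1 = 1 + ε by ring] at I4
    rw [← I4, ← MeasureTheory.integral_const_mul, ← Real.norm_eq_abs]
    apply MeasureTheory.norm_integral_le_of_norm_le ((G_int hp2).const_mul M)
    filter_upwards [ae_mem, hgb] with z hz hz2
    have k0 := K_nonneg (1+ε+1) hz.1 hz.2
    have k1 := K_le_G (p := 1+ε+1) (by linarith) hz.1 hz.2
    rw [norm_mul, Real.norm_of_nonneg k0, mul_comm]
    exact mul_le_mul hz2 k1 k0 hM0
  have b2 : |∫ z, G (1+ε) z * (g z - g (0,0)) ∂(ν.prod ν)| ≤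
      (η + 4 * M) * (1 / ε) - 2 * M * (L 1 δ ^ (-ε) / ε) - 2 * M * (L 1 δ ^ (-ε) / ε) := by
    have hI : (η + 4 * M) * (1 / ε) - 2 * M * (L 1 δ ^ (-ε) / ε) - 2 * M * (L 1 δ ^ (-ε) / ε) =
        (η + 4 * M) * (∫ z, G (1+ε) z ∂(ν.prod ν)) -
          2 * M * (∫ z, G (1+ε) z * φ δ z.1 ∂(ν.prod ν)) -
          2 * M * (∫ z, G (1+ε) z * φ δ z.2 ∂(ν.prod ν)) := by
      rw [I1, I2, I3]
    have j1 : Integrable (fun z => (η + 4 * M) * G (1+ε) z - 2 * M * (G (1+ε) z * φ δ z.1))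
        (ν.prod ν) := (iG.const_mul _).sub ((Gφ_int hp δ).const_mul _)
    have j2 : Integrable (fun z => (η + 4 * M) * G (1+ε) z - 2 * M * (G (1+ε) z * φ δ z.1)
        - 2 * M * (G (1+ε) z * φ δ z.2)) (ν.prod ν) := j1.sub ((Gφ_int' hp δ).const_mul _)
    rw [hI]
    rw [← MeasureTheory.integral_const_mul, ← MeasureTheory.integral_const_mul, ← MeasureTheory.integral_const_mul,
      ← MeasureTheory.integral_sub (iG.const_mul _) ((Gφ_int hp δ).const_mul _),
      ← MeasureTheory.integral_sub j1
        ((Gφ_int' hp δ).const_mul _), ← Real.norm_eq_abs]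
    apply MeasureTheory.norm_integral_le_of_norm_le
      j2
    filter_upwards [ae_mem, hgb] with z hz hz2
    have k0 := G_nonneg (p := 1+ε) (by linarith) hz.1 hz.2
    rw [norm_mul, Real.norm_of_nonneg k0]
    have : ‖g z - g (0,0)‖ ≤ η + 2 * M * (1 - φ δ z.1) + 2 * M * (1 - φ δ z.2) := by
      have t : ‖g z - g (0,0)‖ ≤ 2 * M := by
        refine (norm_sub_le _ _).trans ?_
        rw [Real.norm_eq_abs (g (0,0))]; linarith
      by_cases h1 : z.1 ≤ δ
      · by_cases h2 : z.2 ≤ δ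
        · have := hg z ⟨hz.1.1, h1⟩ ⟨hz.2.1, h2⟩
          simpa [φ, h1, h2] using this
        · simp [φ, h1, h2] at t ⊢; linarith
      · by_cases h2 : z.2 ≤ δ
        · simp [φ, h1, h2] at t ⊢; linarith
        · simp [φ, h1, h2] at t ⊢; linarith
    refine (mul_le_mul_of_nonneg_left this k0).trans (le_of_eq ?_)
    ring
  rw [e1]
  set A := ∫ z, G (1+ε) z * g z ∂(ν.prod ν)
  set B := ∫ z, K (1+ε+1) z * g z ∂(ν.prod ν)
  rw [e2] at b2
  have r : ε * (A - (1+ε) * B) - g (0,0) = ε * (A - 1 / ε * g (0,0)) - ε * ((1+ε) * B) := by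
    field_simp
    ring
  rw [r]
  refine (abs_sub _ _).trans ?_
  rw [abs_mul, abs_mul, abs_mul, abs_of_pos hε, abs_of_pos (show 0 < 1 + ε by linarith)]
  have c1 := mul_le_mul_of_nonneg_left b2 hε.le
  have c2 := mul_le_mul_of_nonneg_left (mul_le_mul_of_nonneg_left b1 (show 0 ≤ 1 + ε by linarith)) hε.le
  have d1 : ε * ((η + 4 * M) * (1 / ε) - 2 * M * (L 1 δ ^ (-ε) / ε) - 2 * M * (L 1 δ ^ (-ε) / ε))
    = η + 4 * M * (1 - L 1 δ ^ (-ε)) := by field_simp; ring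
  have d2 : ε * ((1+ε) * (M * (1 / (1+ε)))) = ε * M := by
    have : 1 + ε ≠ 0 := by linarith
    field_simp
  linarith

end Stmt11Aux

open Stmt11Aux in
theorem stmt11 (g : ℝ × ℝ → ℝ) (hg : ContinuousOn g (Set.Icc 0 1 ×ˢ Set.Icc 0 1)) :
    Filter.Tendsto
      (fun ε : ℝ => ε * ∫ r1 in (0:ℝ)..1, ∫ r2 in (0:ℝ)..1,
        4 * g (r1, r2) /
          (r1 * r2 * (1 - Real.log (r1 ^ 2) - Real.log (r2 ^ 2)) ^ 2 *
            (1 + Real.log (1 - Real.log (r1 ^ 2) - Real.log (r2 ^ 2))) ^ (1 + ε)))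
      (nhdsWithin 0 (Set.Ioi 0)) (nhds (g (0, 0))) := by
  obtain ⟨M, hM⟩ := (isCompact_Icc.prod isCompact_Icc).exists_bound_of_continuousOn hg
  have hM' : ∀ z : ℝ × ℝ, z.1 ∈ Icc (0:ℝ) 1 → z.2 ∈ Icc (0:ℝ) 1 → |g z| ≤ M :=
    fun z h1 h2 => hM z ⟨h1, h2⟩
  have hM0 : 0 ≤ M := (abs_nonneg _).trans (hM' (0, 0) (by simp) (by simp))
  have hgm : AEStronglyMeasurable g (ν.prod ν) := by
    unfold ν
    rw [Measure.prod_restrict]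
    exact (hg.mono (prod_mono Ioc_subset_Icc_self Ioc_subset_Icc_self)).aestronglyMeasurable
      (measurableSet_Ioc.prod measurableSet_Ioc)
  have hgb : ∀ᵐ z ∂(ν.prod ν), ‖g z‖ ≤ M := by
    filter_upwards [ae_mem] with z hz
    exact hM' z ⟨hz.1.1.le, hz.1.2⟩ ⟨hz.2.1.le, hz.2.2⟩
  have hT : Tendsto (fun ε : ℝ => ε * ∫ z, K (1 + ε) z * g z ∂(ν.prod ν))
      (nhdsWithin 0 (Set.Ioi 0)) (nhds (g (0, 0))) := by
    rw [Metric.tendsto_nhds]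
    intro η hη
    have hc := Metric.continuousWithinAt_iff.1 (hg (0, 0) (by simp)) (η / 2) (by linarith)
    obtain ⟨d, hd, hdg⟩ := hc
    set δ := min (d / 2) 1 with hδdef
    have hδ : δ ∈ Ioc (0:ℝ) 1 := ⟨by positivity, min_le_right _ _⟩
    have hδd : δ < d := (min_le_left _ _).trans_lt (by linarith)
    have hl : Tendsto (fun ε : ℝ => η / 2 + 4 * M * (1 - L 1 δ ^ (-ε)) + ε * M)
        (nhdsWithin 0 (Set.Ioi 0)) (nhds (η / 2)) := by
      have hL := L_ge one_mem hδ
      have hcont : Continuous (fun ε : ℝ => η / 2 + 4 * M * (1 - L 1 δ ^ (-ε)) + ε * M) := by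
        have : Continuous (fun ε : ℝ => L 1 δ ^ (-ε)) :=
          (Real.continuous_const_rpow (by linarith)).comp continuous_neg
        fun_prop
      have := (hcont.tendsto 0).mono_left (nhdsWithin_le_nhds (s := Ioi 0))
      simpa using this
    filter_upwards [hl.eventually (gt_mem_nhds (show η / 2 < η by linarith)),
      self_mem_nhdsWithin] with ε h1 h2
    rw [Real.dist_eq]
    refine (key h2 hδ hM0 (by linarith) hgm hM' ?_).trans_lt h1
    intro z hz1 hz2
    have : dist z (0, 0) < d := by
      rw [Prod.dist_eq]
      simp only [Real.dist_eq, sub_zero, abs_of_pos hz1.1, abs_of_pos hz2.1]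
      exact max_lt (hz1.2.trans_lt hδd) (hz2.2.trans_lt hδd)
    have := hdg (x := z) ⟨⟨hz1.1.le, hz1.2.trans hδ.2⟩, ⟨hz2.1.le, hz2.2.trans hδ.2⟩⟩ this
    rw [Real.dist_eq] at this
    exact this.le
  refine hT.congr' ?_
  filter_upwards [self_mem_nhdsWithin] with ε hε
  have hp : 1 < 1 + ε := by have : 0 < ε := hε; linarith
  rw [integral_prod _ ((K_int hp).mul_bdd (c := M) hgm hgb)]
  simp only [intervalIntegral.integral_of_le zero_le_one]
  change ε * ∫ x, ∫ y, K (1+ε) (x, y) * g (x, y) ∂ν ∂ν = ε * ∫ x, ∫ y, _ ∂ν ∂ν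
  congr 2
  funext x
  congr 1
  funext y
  simp only [K, L, U]
  ring
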